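/- Let Γ = {(√5)^n : n ∈ ℤ} ⊆ ℝ. There is no unital subring R of ℝ whose group of positive invertible elements equals Γ, i.e. no subring R of ℝ satisfies {t ∈ ℝ : t > 0, t ∈ R, t⁻¹ ∈ R} = Γ. (Indeed, any such R would contain ℤ + ℤ√5, hence the positive unit √5 − 2, which does not lie in Γ.) -/

import Mathlib

/-- there is no unital subring `R` of `ℝ` whose group of positive
invertible elements `{t > 0 | t ∈ R, t⁻¹ ∈ R}` equals `Γ = {(√5)ⁿ : n ∈ ℤ}`. -/
theorem no_subring_posUnits_eq_sqrt5_powers :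
    ¬ ∃ R : Subring ℝ, {t : ℝ | 0 < t ∧ t ∈ R ∧ t⁻¹ ∈ R} =
      {x : ℝ | ∃ n : ℤ, x = Real.sqrt 5 ^ n} := by
  rintro ⟨R, hR⟩
  have hsq : Real.sqrt 5 * Real.sqrt 5 = 5 := Real.mul_self_sqrt (by norm_num)
  have h0 : 0 ≤ Real.sqrt 5 := Real.sqrt_nonneg 5
  have h2 : 2 < Real.sqrt 5 := by nlinarith
  have h3 : Real.sqrt 5 < 3 := by nlinarith
  have hs : Real.sqrt 5 ∈ {t : ℝ | 0 < t ∧ t ∈ R ∧ t⁻¹ ∈ R} := by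
    rw [hR]; exact ⟨1, by simp⟩
  have hsR : Real.sqrt 5 ∈ R := hs.2.1
  have h2R : (2 : ℝ) ∈ R := ofNat_mem R 2
  have hinv : (Real.sqrt 5 + 2)⁻¹ = Real.sqrt 5 - 2 :=
    inv_eq_of_mul_eq_one_right (by linarith)
  have hu : Real.sqrt 5 + 2 ∈ {x : ℝ | ∃ n : ℤ, x = Real.sqrt 5 ^ n} := by
    rw [← hR]
    refine ⟨by linarith, R.add_mem hsR h2R, ?_⟩
    rw [hinv]; exact R.sub_mem hsR h2R
  obtain ⟨n, hn⟩ := hu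
  have hone : 1 < Real.sqrt 5 := by linarith
  have ha : (1 : ℤ) < n := by
    rw [← zpow_lt_zpow_iff_right₀ hone, ← hn, zpow_one]; linarith
  have hb : n < (2 : ℤ) := by
    rw [← zpow_lt_zpow_iff_right₀ hone, ← hn, zpow_two, hsq]; linarith
  omega
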